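/- arXiv:2005.11141 — 2 statements merged into one kernel-verified Lean document; each statement's English description precedes it below -/
import Mathlib

section
/- Covariant dynamics of the position for the generalized (Ri) harmonic oscillator: the QCPB satisfies (i/ℏ)·[Ĥ^(ri), x̂] = (1/m)·p̂^(ri) + x̂∘ŵ^(ri), as an identity of operators applied to every smooth f : ℝ → ℂ. -/
noncomputable section
open Complex

/-- Operators acting on functions `ℝ → ℂ`. -/
abbrev Op : Type := (ℝ → ℂ) → (ℝ → ℂ)

/-- Multiplication operator by a real-valued function. -/
def mulOp (g : ℝ → ℝ) : Op := fun f x => (g x : ℂ) * f x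

/-- Quantum Poisson bracket `[A,B]_QPB = A∘B − B∘A`. -/
def QPB (A B : Op) : Op := fun f => A (B f) - B (A f)

/-- Quantum covariant Poisson bracket
`[A,B] = [A,B]_QPB + A∘[s,B]_QPB − B∘[s,A]_QPB`. -/
def QCPB (s : ℝ → ℝ) (A B : Op) : Op :=
  fun f => QPB A B f + A (QPB (mulOp s) B f) - B (QPB (mulOp s) A f)

/-- Position (multiplication by `x`). -/
def xhat : Op := fun f x => (x : ℂ) * f x

/-- Classical momentum operator `p̂⁽ᶜˡ⁾ f = −iℏ f'`. -/
def pcl (ℏ : ℝ) : Op := fun f x => -Complex.I * (ℏ : ℂ) * deriv f x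

/-- Classical harmonic-oscillator Hamiltonian. -/
def Hcl (ℏ m ω : ℝ) : Op := fun f x =>
  -((ℏ : ℂ) ^ 2 / (2 * (m : ℂ))) * deriv (deriv f) x
    + ((m : ℂ) * (ω : ℂ) ^ 2 / 2) * (x : ℂ) ^ 2 * f x

/-- Geomentum operator `p̂⁽ʳⁱ⁾ f = −iℏ (f' + u f)` with `u = s'`. -/
def pri (ℏ : ℝ) (s : ℝ → ℝ) : Op := fun f x =>
  -Complex.I * (ℏ : ℂ) * (deriv f x + ((deriv s x : ℝ) : ℂ) * f x)

/-- Ri-operator Hamiltonian `Ĥ⁽ʳⁱ⁾ = (1/2m) p̂⁽ʳⁱ⁾∘p̂⁽ʳⁱ⁾ + (mω²/2)x²`. -/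
def Hri (ℏ m ω : ℝ) (s : ℝ → ℝ) : Op := fun f x =>
  (1 / (2 * (m : ℂ))) * pri ℏ s (pri ℏ s f) x
    + ((m : ℂ) * (ω : ℂ) ^ 2 / 2) * (x : ℂ) ^ 2 * f x

/-- G-dynamics operator `ŵ⁽ᶜˡ⁾ f = −(iℏ/2m)(2u f' + u' f)`. -/
def wcl (ℏ m : ℝ) (s : ℝ → ℝ) : Op := fun f x =>
  -(Complex.I * (ℏ : ℂ) / (2 * (m : ℂ))) *
    (2 * ((deriv s x : ℝ) : ℂ) * deriv f x + ((deriv (deriv s) x : ℝ) : ℂ) * f x)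

/-- Ri G-dynamics operator `ŵ⁽ʳⁱ⁾ f = −(iℏ/2m)(2u f' + u' f + 2u² f)`. -/
def wri (ℏ m : ℝ) (s : ℝ → ℝ) : Op := fun f x =>
  -(Complex.I * (ℏ : ℂ) / (2 * (m : ℂ))) *
    (2 * ((deriv s x : ℝ) : ℂ) * deriv f x + ((deriv (deriv s) x : ℝ) : ℂ) * f x
      + 2 * ((deriv s x : ℝ) : ℂ) ^ 2 * f x)

/-- Annihilation operator. -/
def aOp (ℏ m ω : ℝ) : Op := fun f x =>
  (Real.sqrt (m * ω / (2 * ℏ)) : ℂ) *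
    ((x : ℂ) * f x + ((ℏ : ℂ) / ((m : ℂ) * (ω : ℂ))) * deriv f x)

/-- Creation operator. -/
def adOp (ℏ m ω : ℝ) : Op := fun f x =>
  (Real.sqrt (m * ω / (2 * ℏ)) : ℂ) *
    ((x : ℂ) * f x - ((ℏ : ℂ) / ((m : ℂ) * (ω : ℂ))) * deriv f x)

/-- `b`: multiplication by `√(ℏ/2mω)·u`. -/
def bOp (ℏ m ω : ℝ) (s : ℝ → ℝ) : Op :=
  mulOp (fun x => Real.sqrt (ℏ / (2 * m * ω)) * deriv s x)

/-- Number operator `N̂ = a†∘a`. -/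
def NOp (ℏ m ω : ℝ) : Op := fun f => adOp ℏ m ω (aOp ℏ m ω f)

/-- `N̂⁽ᶜᵍ⁾ = −(i/ω)·ŵ⁽ᶜˡ⁾`. -/
def Ncg (ℏ m ω : ℝ) (s : ℝ → ℝ) : Op := fun f x =>
  -(Complex.I / (ω : ℂ)) * wcl ℏ m s f x

/-- Geometric annihilation operator `a⁽ˢ⁾ = a + b`. -/
def asOp (ℏ m ω : ℝ) (s : ℝ → ℝ) : Op := fun f x =>
  aOp ℏ m ω f x + bOp ℏ m ω s f x

/-- Geometric creation operator `a⁽ˢ⁾† = a† − b`. -/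
def adsOp (ℏ m ω : ℝ) (s : ℝ → ℝ) : Op := fun f x =>
  adOp ℏ m ω f x - bOp ℏ m ω s f x

theorem xhat_eq_mulOp_id : xhat = mulOp id := rfl

theorem QPB_mulOp_mulOp (g h : ℝ → ℝ) (f : ℝ → ℂ) : QPB (mulOp g) (mulOp h) f = 0 := by
  funext x
  simp only [QPB, mulOp, Pi.sub_apply, Pi.zero_apply]
  ring

theorem pri_zero (ℏ : ℝ) (s : ℝ → ℝ) : pri ℏ s 0 = 0 := by
  funext x
  simp [pri]

theorem Hri_zero (ℏ m ω : ℝ) (s : ℝ → ℝ) : Hri ℏ m ω s 0 = 0 := by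
  funext x
  simp [Hri, pri_zero]

/-- Leibniz rule for the geomentum operator. -/
theorem pri_mulOp (ℏ : ℝ) (s : ℝ → ℝ) {g : ℝ → ℝ} {f : ℝ → ℂ} {x : ℝ}
    (hg : DifferentiableAt ℝ g x) (hf : DifferentiableAt ℝ f x) :
    pri ℏ s (mulOp g f) x
      = (g x : ℂ) * pri ℏ s f x - Complex.I * (ℏ : ℂ) * ((deriv g x : ℝ) : ℂ) * f x := by
  have h : deriv (mulOp g f) x = ((deriv g x : ℝ) : ℂ) * f x + (g x : ℂ) * deriv f x :=
    (hg.hasDerivAt.ofReal_comp.mul hf.hasDerivAt).deriv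
  simp only [pri, h, mulOp]
  ring

theorem differentiable_mulOp {g : ℝ → ℝ} {f : ℝ → ℂ}
    (hg : Differentiable ℝ g) (hf : Differentiable ℝ f) : Differentiable ℝ (mulOp g f) :=
  fun x => ((hg x).hasDerivAt.ofReal_comp.mul (hf x).hasDerivAt).differentiableAt

theorem differentiable_pri (ℏ : ℝ) {s : ℝ → ℝ} {f : ℝ → ℂ}
    (hs : Differentiable ℝ (deriv s)) (hf : Differentiable ℝ f)
    (hf' : Differentiable ℝ (deriv f)) : Differentiable ℝ (pri ℏ s f) :=
  (hf'.add (differentiable_mulOp hs hf)).const_mul _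

/-- Commutator of the Ri-operator Hamiltonian with a multiplication operator. -/
theorem QPB_Hri_mulOp (ℏ m ω : ℝ) {s g : ℝ → ℝ} {f : ℝ → ℂ}
    (hs : Differentiable ℝ (deriv s))
    (hg : Differentiable ℝ g) (hg' : Differentiable ℝ (deriv g))
    (hf : Differentiable ℝ f) (hf' : Differentiable ℝ (deriv f)) (x : ℝ) :
    QPB (Hri ℏ m ω s) (mulOp g) f x
      = -((ℏ : ℂ) ^ 2 / (2 * (m : ℂ))) *
        (2 * ((deriv g x : ℝ) : ℂ) * (deriv f x + ((deriv s x : ℝ) : ℂ) * f x)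
          + ((deriv (deriv g) x : ℝ) : ℂ) * f x) := by
  have hp : pri ℏ s (mulOp g f)
      = mulOp g (pri ℏ s f) + fun y => (-Complex.I * (ℏ : ℂ)) * mulOp (deriv g) f y := by
    funext y
    rw [pri_mulOp ℏ s (hg y) (hf y)]
    simp only [mulOp, Pi.add_apply]
    ring
  have hd : Differentiable ℝ (pri ℏ s f) := differentiable_pri ℏ hs hf hf'
  have hm : Differentiable ℝ (mulOp (deriv g) f) := differentiable_mulOp hg' hf
  have hpp : pri ℏ s (pri ℏ s (mulOp g f)) x
      = pri ℏ s (mulOp g (pri ℏ s f)) x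
        + (-Complex.I * (ℏ : ℂ)) * pri ℏ s (mulOp (deriv g) f) x := by
    have h := (((differentiable_mulOp hg hd) x).hasDerivAt.add
      ((hm x).hasDerivAt.const_mul (-Complex.I * (ℏ : ℂ)))).deriv
    rw [hp]
    simp only [pri] at h ⊢
    rw [h]
    simp only [Pi.add_apply]
    ring
  rw [pri_mulOp ℏ s (hg x) (hd x), pri_mulOp ℏ s (hg' x) (hf x)] at hpp
  simp only [QPB, Pi.sub_apply, Hri, hpp]
  simp only [mulOp, Hri]
  have hpri : pri ℏ s f x
      = -Complex.I * (ℏ : ℂ) * (deriv f x + ((deriv s x : ℝ) : ℂ) * f x) := rfl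
  rw [hpri]
  ring_nf
  simp only [Complex.I_sq]
  ring

/-- Covariant dynamics of the position for the generalized (Ri) harmonic oscillator:
`(i/ℏ)·[Ĥ⁽ʳⁱ⁾, x̂] = (1/m)·p̂⁽ʳⁱ⁾ + x̂∘ŵ⁽ʳⁱ⁾`. -/
theorem covariant_dynamics_position_ri (ℏ m ω : ℝ)
    (hℏ : 0 < ℏ) (hm : 0 < m) (hω : 0 < ω)
    (s : ℝ → ℝ) (hs : ContDiff ℝ (⊤ : ℕ∞) s) :
    ∀ f : ℝ → ℂ, ContDiff ℝ (⊤ : ℕ∞) f → ∀ x : ℝ,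
      (Complex.I / (ℏ : ℂ)) * QCPB s (Hri ℏ m ω s) xhat f x
        = (1 / (m : ℂ)) * pri ℏ s f x + (x : ℂ) * wri ℏ m s f x := by
  intro f hf x
  have hs₁ : Differentiable ℝ s := hs.differentiable (by simp)
  have hs₂ : Differentiable ℝ (deriv s) :=
    ((contDiff_infty_iff_deriv.mp hs).2).differentiable (by simp)
  have hf₁ : Differentiable ℝ f := hf.differentiable (by simp)
  have hf₂ : Differentiable ℝ (deriv f) :=
    ((contDiff_infty_iff_deriv.mp hf).2).differentiable (by simp)
  have hid : deriv (id : ℝ → ℝ) = fun _ => 1 := deriv_id'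
  have hX := QPB_Hri_mulOp ℏ m ω hs₂ differentiable_id
    (by rw [hid]; exact differentiable_const _) hf₁ hf₂ x
  have hS := QPB_Hri_mulOp ℏ m ω hs₂ hs₁ hs₂ hf₁ hf₂ x
  have hneg : QPB (mulOp s) (Hri ℏ m ω s) f x = -QPB (Hri ℏ m ω s) (mulOp s) f x := by
    simp [QPB]
  have hℏ' : (ℏ : ℂ) ≠ 0 := by exact_mod_cast hℏ.ne'
  have hm' : (m : ℂ) ≠ 0 := by exact_mod_cast hm.ne'
  simp only [QCPB, xhat_eq_mulOp_id, QPB_mulOp_mulOp, Hri_zero, Pi.add_apply, Pi.sub_apply,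
    Pi.zero_apply, hX]
  rw [mulOp, hneg, hS]
  simp only [hid, deriv_const, id, pri, wri, Complex.ofReal_one, Complex.ofReal_zero]
  field_simp
  ring
end
end

section
/- The quantum Poisson bracket of the structural function with the number operator N̂ = a†∘a is [s, N̂]_QPB = (i/ω)·ŵ^(cl): for every smooth f : ℝ → ℂ, s·(a†(a f)) − a†(a(s·f)) = (i/ω)·(−(iℏ/2m))(2u f' + u' f). -/
noncomputable section
open Complex

/-- On smooth functions, `N̂ f = (mω/2ℏ)(x² − k − k² d²/dx²) f` with `k = ℏ/mω`. -/
theorem NOp_apply {ℏ m ω : ℝ} (h : 0 ≤ m * ω / (2 * ℏ)) {f : ℝ → ℂ}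
    (hf : ContDiff ℝ (⊤ : ℕ∞) f) (x : ℝ) :
    NOp ℏ m ω f x = ((m : ℂ) * ω / (2 * ℏ)) *
      ((x : ℂ) ^ 2 * f x - ((ℏ : ℂ) / (m * ω)) * f x
        - ((ℏ : ℂ) / (m * ω)) ^ 2 * deriv (deriv f) x) := by
  have hf' : ContDiff ℝ (⊤ : ℕ∞) (deriv f) := (contDiff_infty_iff_deriv.mp hf).2
  have d₀ : HasDerivAt f (deriv f x) x := (hf.differentiable (by simp) x).hasDerivAt
  have d₁ : HasDerivAt (deriv f) (deriv (deriv f) x) x :=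
    (hf'.differentiable (by simp) x).hasDerivAt
  have dx : HasDerivAt (fun y : ℝ => (y : ℂ)) 1 x := Complex.ofRealCLM.hasDerivAt
  have da : deriv (aOp ℏ m ω f) x = _ :=
    (((dx.mul d₀).add (d₁.const_mul ((ℏ : ℂ) / ((m : ℂ) * (ω : ℂ))))).const_mul
      (Real.sqrt (m * ω / (2 * ℏ)) : ℂ)).deriv
  have hsq : (Real.sqrt (m * ω / (2 * ℏ)) : ℂ) ^ 2 = (m : ℂ) * ω / (2 * ℏ) := by
    rw [← Complex.ofReal_pow, Real.sq_sqrt h]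
    push_cast
    rfl
  simp only [NOp, adOp, da]
  rw [← hsq]
  simp only [aOp]
  ring

/-- Leibniz rule for multiplication by a smooth real-valued function. -/
theorem deriv_mulOp {s : ℝ → ℝ} {f : ℝ → ℂ} (hs : Differentiable ℝ s)
    (hf : Differentiable ℝ f) :
    deriv (mulOp s f) = mulOp (deriv s) f + mulOp s (deriv f) :=
  funext fun x => ((hs x).hasDerivAt.ofReal_comp.mul (hf x).hasDerivAt).deriv

theorem contDiff_mulOp {s : ℝ → ℝ} {f : ℝ → ℂ} (hs : ContDiff ℝ (⊤ : ℕ∞) s)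
    (hf : ContDiff ℝ (⊤ : ℕ∞) f) : ContDiff ℝ (⊤ : ℕ∞) (mulOp s f) :=
  (Complex.ofRealCLM.contDiff.comp hs).mul hf

theorem deriv_deriv_mulOp {s : ℝ → ℝ} {f : ℝ → ℂ} (hs : ContDiff ℝ (⊤ : ℕ∞) s)
    (hf : ContDiff ℝ (⊤ : ℕ∞) f) (x : ℝ) :
    deriv (deriv (mulOp s f)) x = ((deriv (deriv s) x : ℝ) : ℂ) * f x
      + 2 * ((deriv s x : ℝ) : ℂ) * deriv f x + (s x : ℂ) * deriv (deriv f) x := by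
  obtain ⟨ds, hs'⟩ := contDiff_infty_iff_deriv.mp hs
  obtain ⟨df, hf'⟩ := contDiff_infty_iff_deriv.mp hf
  rw [deriv_mulOp ds df,
    deriv_add ((contDiff_mulOp hs' hf).differentiable (by simp) x)
      ((contDiff_mulOp hs hf').differentiable (by simp) x),
    deriv_mulOp (hs'.differentiable (by simp)) df,
    deriv_mulOp ds (hf'.differentiable (by simp))]
  simp only [Pi.add_apply, mulOp]
  ring

/-- `[s, N̂]_QPB = (i/ω)·ŵ⁽ᶜˡ⁾` for the number operator `N̂ = a†∘a`. -/
theorem qpb_structural_number (ℏ m ω : ℝ)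
    (hℏ : 0 < ℏ) (hm : 0 < m) (hω : 0 < ω)
    (s : ℝ → ℝ) (hs : ContDiff ℝ (⊤ : ℕ∞) s) :
    ∀ f : ℝ → ℂ, ContDiff ℝ (⊤ : ℕ∞) f → ∀ x : ℝ,
      QPB (mulOp s) (NOp ℏ m ω) f x
        = (Complex.I / (ω : ℂ)) * (-(Complex.I * (ℏ : ℂ) / (2 * (m : ℂ)))) *
            (2 * ((deriv s x : ℝ) : ℂ) * deriv f x + ((deriv (deriv s) x : ℝ) : ℂ) * f x) := by
  intro f hf x
  have h : 0 ≤ m * ω / (2 * ℏ) := by positivity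
  have hℏ' : (ℏ : ℂ) ≠ 0 := by exact_mod_cast hℏ.ne'
  have hm' : (m : ℂ) ≠ 0 := by exact_mod_cast hm.ne'
  have hω' : (ω : ℂ) ≠ 0 := by exact_mod_cast hω.ne'
  simp only [QPB, Pi.sub_apply]
  rw [NOp_apply h (contDiff_mulOp hs hf), deriv_deriv_mulOp hs hf]
  simp only [mulOp]
  rw [NOp_apply h hf]
  field_simp
  rw [Complex.I_sq]
  ring
end
end
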